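/- Let Ω ⊂ ℂ be a bounded domain with real-analytic simple closed boundary which is symmetric with respect to the real axis, i.e. {conj ζ : ζ ∈ Ω} = Ω. Let r > 0 be such that (Ω̄ − ir) ∩ (Ω̄ + ir) = ∅, and set K = ⋃_{t ∈ [−r,r]} (bΩ + it). Let f : K → ℂ be continuous and suppose that for each t ∈ [−r,r] there is a continuous function g_t on Ω̄ + it which is holomorphic on Ω + it and satisfies g_t = f on bΩ + it. Then f is holomorphic on the interior of K (note that under these hypotheses K = ⋃_{t ∈ [−r,r]} (Ω̄ + it), so f is defined on all of K). -/

import Mathlib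

open Complex Set

section

open Filter Topology MeasureTheory Metric
open scoped Interval ComplexConjugate

/-- A continuous function on a disc that is holomorphic off a vertical line has zero integral over
rectangles. -/
theorem isConservativeOn_ball_of_differentiableAt_off_line {f : ℂ → ℂ} {c : ℂ} {ρ x₀ : ℝ}
    (hf : ContinuousOn f (ball c ρ))
    (hd : ∀ z ∈ ball c ρ, z.re ≠ x₀ → DifferentiableAt ℂ f z) :
    IsConservativeOn f (ball c ρ) := by
  intro z w hzw
  rw [← add_eq_zero_iff_eq_neg, wedgeIntegral_add_wedgeIntegral_eq]
  have key : ∀ a ∈ [[z.re, w.re]], ∀ b ∈ [[z.re, w.re]], x₀ ∉ Ioo (min a b) (max a b) →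
      (∫ x : ℝ in a..b, f (x + z.im * I)) - (∫ x : ℝ in a..b, f (x + w.im * I)) +
        I • (∫ y : ℝ in z.im..w.im, f (b + y * I)) -
        I • (∫ y : ℝ in z.im..w.im, f (a + y * I)) = 0 := by
    intro a ha b hb hab
    have hsub : [[a, b]] ×ℂ [[z.im, w.im]] ⊆ ball c ρ := by
      refine Subset.trans ?_ hzw
      intro p hp
      exact ⟨uIcc_subset_uIcc ha hb hp.1, hp.2⟩
    have := integral_boundary_rect_eq_zero_of_continuousOn_of_differentiableOn f
      (⟨a, z.im⟩ : ℂ) (⟨b, w.im⟩ : ℂ) (hf.mono hsub) (by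
        intro p hp
        refine (hd p (hsub ?_) ?_).differentiableWithinAt
        · exact ⟨Ioo_subset_Icc_self hp.1, Ioo_subset_Icc_self hp.2⟩
        · rintro rfl
          exact hab hp.1)
    simpa using this
  have hint : ∀ a ∈ [[z.re, w.re]], ∀ b ∈ [[z.re, w.re]], ∀ y ∈ [[z.im, w.im]],
      IntervalIntegrable (fun x : ℝ => f (x + y * I)) volume a b := by
    intro a ha b hb y hy
    refine (hf.comp (by fun_prop) ?_).intervalIntegrable
    intro x hx
    refine hzw ⟨?_, ?_⟩
    · simpa using uIcc_subset_uIcc ha hb hx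
    · simpa using hy
  by_cases hx : x₀ ∈ [[z.re, w.re]]
  · have h1 := key z.re left_mem_uIcc x₀ hx (by
      rintro ⟨h, h'⟩
      rcases le_total z.re x₀ with h2 | h2 <;> simp [h2] at h h')
    have h2 := key x₀ hx w.re right_mem_uIcc (by
      rintro ⟨h, h'⟩
      rcases le_total x₀ w.re with h2 | h2 <;> simp [h2] at h h')
    rw [← intervalIntegral.integral_add_adjacent_intervals
        (hint z.re left_mem_uIcc x₀ hx _ left_mem_uIcc)
        (hint x₀ hx w.re right_mem_uIcc _ left_mem_uIcc),
      ← intervalIntegral.integral_add_adjacent_intervals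
        (hint z.re left_mem_uIcc x₀ hx _ right_mem_uIcc)
        (hint x₀ hx w.re right_mem_uIcc _ right_mem_uIcc)]
    linear_combination h1 + h2
  · exact key _ left_mem_uIcc _ right_mem_uIcc fun h => hx (Ioo_subset_Icc_self h)

/-- Finitely many vertical lines are removable for continuous functions. -/
theorem differentiableOn_of_continuousOn_of_finite_lines {f : ℂ → ℂ} {U : Set ℂ} (hU : IsOpen U)
    (hf : ContinuousOn f U) {X : Set ℝ} (hX : X.Finite)
    (hd : ∀ z ∈ U, z.re ∉ X → DifferentiableAt ℂ f z) : DifferentiableOn ℂ f U := by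
  intro c hc
  have hV : IsOpen (U ∩ re ⁻¹' (X \ {c.re})ᶜ) :=
    hU.inter ((hX.subset sdiff_subset).isClosed.isOpen_compl.preimage continuous_re)
  obtain ⟨ρ, hρ, hball⟩ := Metric.isOpen_iff.1 hV c ⟨hc, by simp⟩
  have hcons := isConservativeOn_ball_of_differentiableAt_off_line (x₀ := c.re)
    (hf.mono fun z hz => (hball hz).1) (fun z hz hzc => hd z (hball hz).1 fun hzX =>
      (hball hz).2 ⟨hzX, hzc⟩)
  have := (hcons.isExactOn_ball (hf.mono fun z hz => (hball hz).1)).differentiableOn isOpen_ball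
  exact (this.differentiableAt (ball_mem_nhds c hρ)).differentiableWithinAt

/-- Differentiation under the integral sign for holomorphic integrands. -/
theorem differentiableOn_intervalIntegral_of_continuousOn {Φ : ℂ → ℝ → ℂ} {U : Set ℂ}
    (hU : IsOpen U) {a b : ℝ} (hab : a ≤ b)
    (hc : ContinuousOn (fun p : ℂ × ℝ => Φ p.1 p.2) (U ×ˢ Icc a b))
    (hd : ∀ t ∈ Icc a b, DifferentiableOn ℂ (fun w => Φ w t) U) :
    DifferentiableOn ℂ (fun w => ∫ t in a..b, Φ w t) U := by
  intro w₀ hw₀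
  obtain ⟨ρ, hρ, hball⟩ := Metric.isOpen_iff.1 hU w₀ hw₀
  have hcb : closedBall w₀ (ρ / 2) ⊆ U :=
    (closedBall_subset_ball (by linarith)).trans hball
  have hcont : ∀ w ∈ U, ContinuousOn (Φ w) (Icc a b) := fun w hw =>
    hc.comp (f := fun t => ((w, t) : ℂ × ℝ)) (by fun_prop) fun t ht => ⟨hw, ht⟩
  have hmeas : ∀ w ∈ U, AEStronglyMeasurable (Φ w) (volume.restrict (Ι a b)) := fun w hw => by
    rw [uIoc_of_le hab]
    exact ((hcont w hw).mono Ioc_subset_Icc_self).aestronglyMeasurable measurableSet_Ioc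
  obtain ⟨C, hC⟩ := ((isCompact_closedBall w₀ (ρ / 2)).prod
    (isCompact_Icc (a := a) (b := b))).exists_bound_of_continuousOn
      (hc.mono (prod_mono hcb subset_rfl))
  have hderiv : ∀ t ∈ Icc a b, ∀ w ∈ U, HasDerivAt (fun w => Φ w t) (deriv (fun w => Φ w t) w) w :=
    fun t ht w hw => ((hd t ht).differentiableAt (hU.mem_nhds hw)).hasDerivAt
  have hsub : Ι a b ⊆ Icc a b := by
    rw [uIoc_of_le hab]; exact Ioc_subset_Icc_self
  have hbound : ∀ t ∈ Icc a b, ∀ w ∈ ball w₀ (ρ / 4),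
      ‖deriv (fun w => Φ w t) w‖ ≤ C / (ρ / 4) := by
    intro t ht w hw
    have hs : closedBall w (ρ / 4) ⊆ closedBall w₀ (ρ / 2) :=
      closedBall_subset_closedBall' (by rw [mem_ball] at hw; linarith)
    refine norm_deriv_le_of_forall_mem_sphere_norm_le (by positivity) ?_ ?_
    · refine DifferentiableOn.diffContOnCl ?_
      rw [closure_ball _ (by positivity)]
      exact (hd t ht).mono (hs.trans hcb)
    · intro z hz
      exact hC (z, t) ⟨hs (sphere_subset_closedBall hz), ht⟩
  have hres := intervalIntegral.hasDerivAt_integral_of_dominated_loc_of_deriv_le (μ := volume)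
    (F := Φ) (F' := fun w t => deriv (fun w => Φ w t) w) (x₀ := w₀) (a := a) (b := b)
    (bound := fun _ => C / (ρ / 4)) (ball_mem_nhds w₀ (by positivity : 0 < ρ / 4))
    (by filter_upwards [hU.mem_nhds hw₀] with w hw using hmeas w hw)
    ((hcont w₀ hw₀).intervalIntegrable_of_Icc hab)
    ?_ (Eventually.of_forall fun t ht w hw => hbound t (hsub ht) w hw)
    intervalIntegrable_const
    (Eventually.of_forall fun t ht w hw => hderiv t (hsub ht) w (hcb
      (closedBall_subset_closedBall (by linarith) (ball_subset_closedBall hw))))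
  · exact hres.2.differentiableAt.differentiableWithinAt
  · set h : ℕ → ℂ := fun n => ((ρ / 2 / ((n : ℝ) + 1) : ℝ) : ℂ) with hh
    have hpos : ∀ n : ℕ, 0 < ρ / 2 / ((n : ℝ) + 1) := fun n => by positivity
    have hmem : ∀ n, w₀ + h n ∈ U := by
      intro n
      apply hcb
      rw [mem_closedBall, dist_eq_norm, add_sub_cancel_left, hh]
      simp only [norm_real, Real.norm_eq_abs, abs_of_pos (hpos n)]
      exact div_le_self (by positivity) (by linarith [n.cast_nonneg (α := ℝ)])
    have hlim : Tendsto h atTop (𝓝[≠] 0) := by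
      rw [tendsto_nhdsWithin_iff]
      refine ⟨?_, Eventually.of_forall fun n => ?_⟩
      · have : Tendsto (fun n : ℕ => ρ / 2 / ((n : ℝ) + 1)) atTop (𝓝 0) :=
          tendsto_const_nhds.div_atTop
            (tendsto_atTop_add_const_right _ _ tendsto_natCast_atTop_atTop)
        simpa [hh, Function.comp_def] using (continuous_ofReal.tendsto 0).comp this
      · simp only [hh, mem_compl_iff, mem_singleton_iff, ofReal_eq_zero]
        exact (hpos n).ne'
    refine aestronglyMeasurable_of_tendsto_ae (u := atTop)
      (f := fun n t => (h n)⁻¹ • (Φ (w₀ + h n) t - Φ w₀ t)) ?_ ?_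
    · intro n
      exact ((hmeas _ (hmem n)).sub (hmeas _ hw₀)).const_smul (h n)⁻¹
    · refine (ae_restrict_mem measurableSet_uIoc).mono fun t ht => ?_
      have := (hderiv t (hsub ht) w₀ hw₀).tendsto_slope_zero
      exact this.comp hlim

/-- Maximum principle for the imaginary part of a holomorphic function. -/
theorem im_le_of_forall_mem_frontier_im_le {P : ℂ → ℂ} {Ω : Set ℂ} (hb : Bornology.IsBounded Ω)
    (hP : DiffContOnCl ℂ P Ω) {ε : ℝ} (h : ∀ ζ ∈ frontier Ω, (P ζ).im ≤ ε) {z : ℂ}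
    (hz : z ∈ closure Ω) : (P z).im ≤ ε := by
  have hexp : DiffContOnCl ℂ (fun ζ => cexp (-I * P ζ)) Ω :=
    Complex.differentiable_exp.comp_diffContOnCl (hP.const_smul (-I))
  have := norm_le_of_forall_mem_frontier_norm_le hb hexp (C := Real.exp ε) (fun ζ hζ => by
    simpa [Complex.norm_exp] using h ζ hζ) hz
  simpa [Complex.norm_exp] using this

/-- A Borel–Carathéodory estimate on a connected open set: the oscillation of a holomorphic
function between two points is controlled by the size of its imaginary part. -/
theorem exists_norm_sub_le_of_abs_im_le {Ω : Set ℂ} (ho : IsOpen Ω) (hc : IsPreconnected Ω)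
    {z z' : ℂ} (hz : z ∈ Ω) (hz' : z' ∈ Ω) :
    ∃ C, ∀ P : ℂ → ℂ, DifferentiableOn ℂ P Ω → ∀ ε > 0, (∀ ζ ∈ Ω, |(P ζ).im| ≤ ε) →
      ‖P z - P z'‖ ≤ C * ε := by
  refine hc.induction₂ (fun z z' => ∃ C, ∀ P : ℂ → ℂ, DifferentiableOn ℂ P Ω → ∀ ε > 0,
    (∀ ζ ∈ Ω, |(P ζ).im| ≤ ε) → ‖P z - P z'‖ ≤ C * ε) ?_ ?_ ?_ hz hz'
  · intro c hc
    obtain ⟨ρ, hρ, hball⟩ := Metric.isOpen_iff.1 ho c hc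
    refine mem_nhdsWithin_of_mem_nhds ?_
    filter_upwards [ball_mem_nhds c (half_pos hρ)] with w hw
    refine ⟨4, fun P hP ε hε him => ?_⟩
    have hmaps : ∀ ζ ∈ ball (0 : ℂ) ρ, c + ζ ∈ Ω := fun ζ hζ => hball (by simpa using hζ)
    have hwn : ‖w - c‖ < ρ / 2 := by simpa [dist_eq_norm] using hw
    have key := borelCaratheodory_zero (M := 2 * ε) (R := ρ) (z := w - c)
      (f := fun ζ => -I * (P (c + ζ) - P c)) (by positivity)
      (((hP.comp (by fun_prop) hmaps).sub_const _).const_mul _) ?_ hρ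
      (by rw [mem_ball_zero_iff]; linarith) (by simp)
    · rw [norm_mul, norm_neg, norm_I, one_mul, add_sub_cancel, norm_sub_rev] at key
      refine key.trans ?_
      rw [div_le_iff₀ (by linarith)]
      nlinarith [norm_nonneg (w - c)]
    · intro ζ hζ
      have h1 := (abs_le.1 (him _ (hmaps ζ hζ))).2
      have h2 := (abs_le.1 (him _ hc)).1
      simp
      linarith
  · rintro x y w hx hy hw ⟨C, hC⟩ ⟨C', hC'⟩
    refine ⟨C + C', fun P hP ε hε him => ?_⟩
    have := norm_sub_le_norm_sub_add_norm_sub (P x) (P y) (P w)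
    nlinarith [hC P hP ε hε him, hC' P hP ε hε him]
  · rintro x y hx hy ⟨C, hC⟩
    exact ⟨C, fun P hP ε hε him => by rw [norm_sub_rev]; exact hC P hP ε hε him⟩

/-- On a bounded domain symmetric about the real axis, the oscillation of a holomorphic function
between two points is controlled by the odd part of its boundary values. -/
theorem exists_norm_sub_le_of_norm_sub_conj_le {Ω : Set ℂ} (ho : IsOpen Ω)
    (hc : IsPreconnected Ω) (hb : Bornology.IsBounded Ω) (hs : conj ⁻¹' Ω = Ω)
    {z z' : ℂ} (hz : z ∈ Ω) (hz' : z' ∈ Ω) :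
    ∃ C, ∀ H : ℂ → ℂ, DiffContOnCl ℂ H Ω → ∀ ε > 0,
      (∀ ζ ∈ frontier Ω, ‖H ζ - H (conj ζ)‖ ≤ ε) → ‖H z - H z'‖ ≤ C * ε := by
  obtain ⟨C, hC⟩ := exists_norm_sub_le_of_abs_im_le ho hc hz hz'
  refine ⟨C, fun H hH ε hε hfr => ?_⟩
  have hH' : DiffContOnCl ℂ (fun ζ => conj (H (conj ζ))) Ω := by
    constructor
    · intro ζ hζ
      have h1 : conj ζ ∈ Ω := by rwa [← hs] at hζ
      have := (hH.differentiableAt ho h1).star_star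
      rw [show starRingEnd ℂ ζ = star ζ from rfl, star_star] at this
      exact this.differentiableWithinAt
    · refine continuous_conj.comp_continuousOn
        (hH.continuousOn.comp continuous_conj.continuousOn ?_)
      intro ζ hζ
      have := (Homeomorph.preimage_closure conjCLE.toHomeomorph Ω)
      change conj ⁻¹' closure Ω = closure (conj ⁻¹' Ω) at this
      rw [hs] at this
      rwa [← this] at hζ
  have him : ∀ P : ℂ → ℂ, DiffContOnCl ℂ P Ω → (∀ ζ ∈ frontier Ω, |(P ζ).im| ≤ ε) →
      ∀ ζ ∈ Ω, |(P ζ).im| ≤ ε := by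
    intro P hP hf ζ hζ
    rw [abs_le]
    constructor
    · have := im_le_of_forall_mem_frontier_im_le (ε := ε) hb hP.neg (fun ζ hζ => by
        simpa using neg_le.1 (abs_le.1 (hf ζ hζ)).1) (subset_closure hζ)
      simp at this
      linarith
    · exact im_le_of_forall_mem_frontier_im_le hb hP (fun ζ hζ => (abs_le.1 (hf ζ hζ)).2)
        (subset_closure hζ)
  have h1 := hC _ (hH.add hH').differentiableOn ε hε (him _ (hH.add hH') fun ζ hζ => by
    simpa [sub_eq_add_neg] using (abs_im_le_norm _).trans (hfr ζ hζ))
  have h2 := hC _ ((hH.sub hH').const_smul I).differentiableOn ε hε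
    (him _ ((hH.sub hH').const_smul I) fun ζ hζ => by
      simpa [sub_eq_add_neg] using (abs_re_le_norm _).trans (hfr ζ hζ))
  have e : H z - H z' = (1 / 2 : ℂ) * ((H z + conj (H (conj z)) - (H z' + conj (H (conj z')))) +
      -I * (I * (H z - conj (H (conj z))) - I * (H z' - conj (H (conj z'))))) := by
    ring_nf
    rw [I_sq]
    ring
  rw [e, norm_mul]
  refine (mul_le_mul_of_nonneg_left (norm_add_le _ _) (norm_nonneg _)).trans ?_
  rw [norm_mul (-I), norm_neg, norm_I, one_mul]
  simp only [Pi.add_apply, Pi.sub_apply, Pi.smul_apply, smul_eq_mul] at h1 h2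
  have : ‖(1 / 2 : ℂ)‖ = 1 / 2 := by norm_num
  rw [this]
  linarith

/-- A linear form dominated by the norm of a linear map into a normed space factors through a
continuous linear form on that space. -/
theorem exists_strongDual_comp_eq {V X : Type*} [AddCommGroup V] [Module ℂ V]
    [NormedAddCommGroup X] [NormedSpace ℂ X] (ρ : V →ₗ[ℂ] X) (Λ : V →ₗ[ℂ] ℂ) (C : ℝ)
    (h : ∀ v, ‖Λ v‖ ≤ C * ‖ρ v‖) : ∃ L : StrongDual ℂ X, ∀ v, L (ρ v) = Λ v := by
  have hker : LinearMap.ker ρ ≤ LinearMap.ker Λ := by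
    intro v hv
    rw [LinearMap.mem_ker] at hv ⊢
    have := h v
    rw [hv, norm_zero, mul_zero] at this
    exact norm_le_zero_iff.1 this
  let g : LinearMap.range ρ →ₗ[ℂ] ℂ :=
    (LinearMap.ker ρ).liftQ Λ hker ∘ₗ ρ.quotKerEquivRange.symm.toLinearMap
  have hg : ∀ v, g ⟨ρ v, LinearMap.mem_range_self ρ v⟩ = Λ v := by
    intro v
    have : ρ.quotKerEquivRange.symm ⟨ρ v, LinearMap.mem_range_self ρ v⟩ =
        (LinearMap.ker ρ).mkQ v := by
      rw [LinearEquiv.symm_apply_eq]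
      rfl
    simp [g, this]
  have hgb : ∀ x, ‖g x‖ ≤ C * ‖x‖ := by
    rintro ⟨_, v, rfl⟩
    rw [hg]
    exact h v
  obtain ⟨L, hL, -⟩ := exists_extension_norm_eq _ (g.mkContinuous C hgb)
  exact ⟨L, fun v => by simpa [hg] using hL ⟨ρ v, LinearMap.mem_range_self ρ v⟩⟩

/-- The jump of a Cauchy integral across a vertical segment. -/
theorem tendsto_cauchy_kernel_jump {u : ℝ → ℂ} {r t₀ : ℝ} (hu : ContinuousOn u (Icc (-r) r))
    (ht₀ : t₀ ∈ Ioo (-r) r) :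
    Tendsto (fun c : ℝ => ∫ t in -r..r, u t *
      ((I * (t₀ - t) + (c : ℂ)⁻¹)⁻¹ - (I * (t₀ - t) - (c : ℂ)⁻¹)⁻¹)) atTop
      (𝓝 (2 * Real.pi * u t₀)) := by
  have hr : -r ≤ r := ht₀.1.le.trans ht₀.2.le
  have hg : Integrable ((Ioc (-r) r).indicator u) := by
    rw [integrable_indicator_iff measurableSet_Ioc]
    exact (hu.integrableOn_Icc).mono_set Ioc_subset_Icc_self
  have hgc : ContinuousAt ((Ioc (-r) r).indicator u) t₀ := by
    have h1 : u =ᶠ[𝓝 t₀] (Ioc (-r) r).indicator u := by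
      filter_upwards [Ioo_mem_nhds ht₀.1 ht₀.2] with t ht
      rw [indicator_of_mem (Ioo_subset_Ioc_self ht)]
    exact (hu.continuousAt (Icc_mem_nhds ht₀.1 ht₀.2)).congr h1
  have hlim : Tendsto (fun x : ℝ => ‖x‖ ^ Module.finrank ℝ ℝ * (Real.pi⁻¹ * (1 + x ^ 2)⁻¹))
      (Bornology.cobounded ℝ) (𝓝 0) := by
    have h1 : Tendsto (fun x : ℝ => ‖x‖⁻¹) (Bornology.cobounded ℝ) (𝓝 0) :=
      tendsto_inv_atTop_zero.comp tendsto_norm_cobounded_atTop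
    refine squeeze_zero (fun x => by positivity) (fun x => ?_)
      (by simpa using h1.const_mul Real.pi⁻¹)
    have : ‖x‖ * (1 + x ^ 2)⁻¹ ≤ ‖x‖⁻¹ := by
      rcases eq_or_ne x 0 with rfl | hx
      · simp
      · have : 0 < ‖x‖ := norm_pos_iff.2 hx
        rw [← div_eq_mul_inv, div_le_iff₀ (by positivity), inv_mul_eq_div, le_div_iff₀ this,
          Real.norm_eq_abs, abs_mul_abs_self]
        nlinarith
    rw [Module.finrank_self, pow_one]
    calc ‖x‖ * (Real.pi⁻¹ * (1 + x ^ 2)⁻¹) = Real.pi⁻¹ * (‖x‖ * (1 + x ^ 2)⁻¹) := by ring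
      _ ≤ _ := mul_le_mul_of_nonneg_left this (by positivity)
  have key := tendsto_integral_comp_smul_smul_of_integrable' (μ := (volume : Measure ℝ))
    (φ := fun x : ℝ => Real.pi⁻¹ * (1 + x ^ 2)⁻¹) (fun x => by positivity)
    (by rw [integral_const_mul, integral_univ_inv_one_add_sq]
        exact inv_mul_cancel₀ Real.pi_ne_zero)
    hlim hg hgc
  rw [indicator_of_mem (Ioo_subset_Ioc_self ht₀)] at key
  refine (key.const_mul (2 * Real.pi : ℂ)).congr' ?_
  filter_upwards [eventually_gt_atTop 0] with c hc
  rw [intervalIntegral.integral_of_le hr, ← integral_const_mul,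
    ← integral_indicator measurableSet_Ioc]
  congr 1
  ext t
  by_cases ht : t ∈ Ioc (-r) r
  · rw [indicator_of_mem ht, indicator_of_mem ht, Module.finrank_self, pow_one, real_smul,
      smul_eq_mul]
    have hcc : (c : ℂ) ≠ 0 := by exact_mod_cast hc.ne'
    have hpi : (Real.pi : ℂ) ≠ 0 := by exact_mod_cast Real.pi_ne_zero
    have h1 : I * ((t₀ : ℂ) - t) + (c : ℂ)⁻¹ ≠ 0 := fun h => by
      have := congrArg re h
      rw [← ofReal_sub, ← ofReal_inv] at this
      simp at this
      exact hc.ne' this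
    have h2 : I * ((t₀ : ℂ) - t) - (c : ℂ)⁻¹ ≠ 0 := fun h => by
      have := congrArg re h
      rw [← ofReal_sub, ← ofReal_inv] at this
      simp at this
      exact hc.ne' this
    have h3 : (1 + (c * (t₀ - t)) ^ 2 : ℂ) ≠ 0 := by
      exact_mod_cast (by positivity : (1 + (c * (t₀ - t)) ^ 2 : ℝ) ≠ 0)
    have h4 : (I * ((t₀ : ℂ) - t) + (c : ℂ)⁻¹) * (I * ((t₀ : ℂ) - t) - (c : ℂ)⁻¹) =
        -(c : ℂ)⁻¹ ^ 2 * (1 + (c * (t₀ - t)) ^ 2) := by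
      field_simp
      ring_nf
      rw [I_sq]
      ring
    rw [inv_sub_inv h1 h2, h4]
    push_cast
    field_simp
    ring
  · rw [indicator_of_notMem ht, indicator_of_notMem ht]
    simp

/-- If `f` on the vertical translates of the boundary of a symmetric domain `Ω` is given by the
boundary values of `G`, the odd part of the vertical average of `G ζ t * E (ζ + I * t)` only
involves the values of `E` away from the real axis. -/
theorem norm_integral_sub_integral_conj_le {Ω : Set ℂ} {f E : ℂ → ℂ} {G : ℂ → ℝ → ℂ}
    {r m M B : ℝ} {K : Set ℂ}
    (hK : ∀ ζ ∈ frontier Ω, ∀ t ∈ Icc (-r) r, ζ + I * t ∈ K) (hf : ContinuousOn f K)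
    (hE : ContinuousOn E K) (hGf : ∀ ζ ∈ frontier Ω, ∀ t ∈ Icc (-r) r, G ζ t = f (ζ + I * t))
    (hmr : m < r) (hM : ∀ p ∈ K, ‖f p‖ ≤ M)
    (hB : ∀ p ∈ K, r - m ≤ |p.im| → ‖E p‖ ≤ B) {ζ : ℂ}
    (hζ : ζ ∈ frontier Ω) (hζ' : conj ζ ∈ frontier Ω) (hm : |ζ.im| ≤ m) :
    ‖(∫ t in -r..r, G ζ t * E (ζ + I * t)) - ∫ t in -r..r, G (conj ζ) t * E (conj ζ + I * t)‖ ≤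
      4 * m * (M * B) := by
  set x := ζ.re
  set y := ζ.im
  have hm' := abs_le.1 hm
  set k : ℝ → ℂ := fun s => f (x + I * s) * E (x + I * s) with hk
  have e1 : ∀ t : ℝ, ζ + I * t = x + I * ((y + t : ℝ) : ℂ) := fun t => by
    apply Complex.ext <;> simp [x, y]
  have e2 : ∀ t : ℝ, conj ζ + I * t = x + I * ((-y + t : ℝ) : ℂ) := fun t => by
    apply Complex.ext <;> simp [x, y]
  have hr : -r ≤ r := by linarith [abs_nonneg y]
  have hmem : ∀ s ∈ Icc (-r - |y|) (r + |y|), (x + I * s : ℂ) ∈ K := by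
    intro s hs
    have h1 : s - y ∈ Icc (-r) r → (x + I * s : ℂ) ∈ K := fun h => by
      have := hK ζ hζ _ h
      rwa [e1, add_sub_cancel] at this
    have h2 : s + y ∈ Icc (-r) r → (x + I * s : ℂ) ∈ K := fun h => by
      have := hK _ hζ' _ h
      rwa [e2, show -y + (s + y) = s by ring] at this
    obtain ⟨hs1, hs2⟩ := hs
    rcases le_total 0 y with hy | hy
    · rw [abs_of_nonneg hy] at hs1 hs2
      rcases le_total 0 s with h | h
      · exact h1 ⟨by linarith, by linarith⟩
      · exact h2 ⟨by linarith, by linarith⟩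
    · rw [abs_of_nonpos hy] at hs1 hs2
      rcases le_total 0 s with h | h
      · exact h2 ⟨by linarith, by linarith⟩
      · exact h1 ⟨by linarith, by linarith⟩
  have hkc : ContinuousOn k (Icc (-r - |y|) (r + |y|)) :=
    (hf.mul hE).comp (f := fun s : ℝ => (x + I * s : ℂ)) (by fun_prop) hmem
  have hint : ∀ a ∈ Icc (-r - |y|) (r + |y|), ∀ b ∈ Icc (-r - |y|) (r + |y|),
      IntervalIntegrable k volume a b := fun a ha b hb =>
    (hkc.mono (ordConnected_Icc.uIcc_subset ha hb)).intervalIntegrable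
  have i1 : (∫ t in -r..r, G ζ t * E (ζ + I * t)) = ∫ s in y + -r..y + r, k s := by
    rw [← intervalIntegral.integral_comp_add_left]
    refine intervalIntegral.integral_congr fun t ht => ?_
    rw [uIcc_of_le hr] at ht
    simp only [hGf ζ hζ t ht, hk, e1]
  have i2 : (∫ t in -r..r, G (conj ζ) t * E (conj ζ + I * t)) = ∫ s in -y + -r..-y + r, k s := by
    rw [← intervalIntegral.integral_comp_add_left]
    refine intervalIntegral.integral_congr fun t ht => ?_
    rw [uIcc_of_le hr] at ht
    simp only [hGf _ hζ' t ht, hk, e2]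
  have hy1 := neg_abs_le y
  have hy2 := le_abs_self y
  have hm0 : 0 ≤ m := (abs_nonneg y).trans hm
  have mem : ∀ s : ℝ, -r - |y| ≤ s → s ≤ r + |y| → s ∈ Icc (-r - |y|) (r + |y|) :=
    fun s h h' => ⟨h, h'⟩
  have hends : ∀ s : ℝ, r - |y| ≤ |s| → |s| ≤ r + |y| → ‖k s‖ ≤ M * B := by
    intro s h1 h2
    have hs : (x + I * s : ℂ) ∈ K := by
      have := abs_le.1 h2
      exact hmem s ⟨by linarith, by linarith⟩
    rw [hk, norm_mul]
    have h3 := hM _ hs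
    refine mul_le_mul h3 (hB _ hs ?_) (norm_nonneg _) ((norm_nonneg _).trans h3)
    simp
    linarith
  rw [i1, i2, intervalIntegral.integral_interval_sub_interval_comm
    (hint _ (mem _ (by linarith) (by linarith)) _ (mem _ (by linarith) (by linarith)))
    (hint _ (mem _ (by linarith) (by linarith)) _ (mem _ (by linarith) (by linarith)))
    (hint _ (mem _ (by linarith) (by linarith)) _ (mem _ (by linarith) (by linarith)))]
  have b1 : ‖∫ s in y + -r..-y + -r, k s‖ ≤ M * B * |-y + -r - (y + -r)| := by
    refine intervalIntegral.norm_integral_le_of_norm_le_const fun s hs => ?_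
    have := uIoc_subset_uIcc hs
    rw [mem_uIcc] at this
    have hs0 : s ≤ 0 := by rcases this with h | h <;> linarith
    refine hends s ?_ ?_ <;> rw [abs_of_nonpos hs0] <;> rcases this with h | h <;> linarith
  have b2 : ‖∫ s in y + r..-y + r, k s‖ ≤ M * B * |-y + r - (y + r)| := by
    refine intervalIntegral.norm_integral_le_of_norm_le_const fun s hs => ?_
    have := uIoc_subset_uIcc hs
    rw [mem_uIcc] at this
    have hs0 : 0 ≤ s := by rcases this with h | h <;> linarith
    refine hends s ?_ ?_ <;> rw [abs_of_nonneg hs0] <;> rcases this with h | h <;> linarith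
  have hMB : 0 ≤ M * B := (norm_nonneg _).trans (hends r (by
    rw [abs_of_nonneg (by linarith : 0 ≤ r)]; linarith) (by
    rw [abs_of_nonneg (by linarith : 0 ≤ r)]; linarith [abs_nonneg y]))
  have a1 : |-y + -r - (y + -r)| ≤ 2 * m := by rw [abs_le]; constructor <;> linarith
  have a2 : |-y + r - (y + r)| ≤ 2 * m := by rw [abs_le]; constructor <;> linarith
  refine (norm_sub_le _ _).trans ((add_le_add b1 b2).trans ?_)
  nlinarith [mul_le_mul_of_nonneg_left a1 hMB, mul_le_mul_of_nonneg_left a2 hMB]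

/-- An integral of functions holomorphic in `Ω` and jointly continuous up to the boundary is
holomorphic in `Ω` and continuous up to the boundary. -/
theorem diffContOnCl_intervalIntegral {Φ : ℂ → ℝ → ℂ} {Ω : Set ℂ} (ho : IsOpen Ω)
    {a b : ℝ} (hab : a ≤ b)
    (hc : ContinuousOn (fun p : ℂ × ℝ => Φ p.1 p.2) (closure Ω ×ˢ Icc a b))
    (hd : ∀ t ∈ Icc a b, DifferentiableOn ℂ (fun w => Φ w t) Ω) :
    DiffContOnCl ℂ (fun w => ∫ t in a..b, Φ w t) Ω := by
  refine ⟨differentiableOn_intervalIntegral_of_continuousOn ho hab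
    (hc.mono (prod_mono subset_closure subset_rfl)) hd, ?_⟩
  rw [continuousOn_iff_continuous_domRestrict]
  have hcont : Continuous fun p : closure Ω × ℝ => Φ p.1 (projIcc a b hab p.2) :=
    hc.comp_continuous (f := fun p : closure Ω × ℝ => ((p.1 : ℂ), (projIcc a b hab p.2 : ℝ)))
      (by fun_prop) fun p => ⟨p.1.2, (projIcc a b hab p.2).2⟩
  refine (intervalIntegral.continuous_parametric_intervalIntegral_of_continuous' (μ := volume)
    (f := fun (z : closure Ω) t => Φ z (projIcc a b hab t)) hcont a b).congr fun z => ?_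
  refine intervalIntegral.integral_congr fun t ht => ?_
  rw [uIcc_of_le hab] at ht
  simp only [projIcc_of_mem hab ht]

/-- The Cauchy transform of a continuous linear form on the continuous functions on a compact set
is holomorphic off that set. -/
theorem exists_differentiableOn_compl_cauchy_transform {Q : Set ℂ} (hQ : IsCompact Q)
    (L : StrongDual ℂ C(Q, ℂ)) : ∃ F : ℂ → ℂ, DifferentiableOn ℂ F Qᶜ ∧
      ∀ w ∉ Q, ∀ φ : C(Q, ℂ), (∀ p : Q, φ p = (w - p)⁻¹) → F w = L φ := by
  have : CompactSpace Q := isCompact_iff_compactSpace.1 hQ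
  set a : C(Q, ℂ) := ⟨Subtype.val, continuous_subtype_val⟩ with ha
  have hres : ∀ w ∉ Q, w ∈ resolventSet ℂ a := fun w hw => by
    by_contra h
    have h1 : w ∈ spectrum ℂ a := h
    rw [ContinuousMap.spectrum_eq_range] at h1
    obtain ⟨p, rfl⟩ := h1
    exact hw p.2
  refine ⟨fun w => L (resolvent a w), fun w hw => ?_, fun w hw φ hφ => ?_⟩
  · exact (L.differentiableAt.comp w
      (spectrum.hasDerivAt_resolvent_const_left
        (hres w hw)).differentiableAt).differentiableWithinAt
  · change L (resolvent a w) = L φ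
    congr 1
    have h1 : φ * (algebraMap ℂ C(Q, ℂ) w - a) = 1 := by
      ext p
      have : w - p ≠ 0 := sub_ne_zero.2 fun h => hw (h ▸ p.2)
      simp [hφ, ha, this]
    have h2 : IsUnit (algebraMap ℂ C(Q, ℂ) w - a) := hres w hw
    calc resolvent a w = φ * (algebraMap ℂ C(Q, ℂ) w - a) * resolvent a w := by rw [h1, one_mul]
      _ = φ := by rw [mul_assoc, resolvent, Ring.mul_inverse_cancel _ h2, mul_one]

/-- The Cauchy integral of a continuous function over the vertical segment through `z` is
holomorphic off the vertical line through `z`. -/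
theorem differentiableOn_cauchy_vertical {u : ℝ → ℂ} {r : ℝ} (hr : -r ≤ r)
    (hu : ContinuousOn u (Icc (-r) r)) (z : ℂ) :
    DifferentiableOn ℂ (fun w => ∫ t in -r..r, u t * (w - (z + I * t))⁻¹) {w | w.re ≠ z.re} := by
  have hne : ∀ w : ℂ, w.re ≠ z.re → ∀ t : ℝ, w - (z + I * t) ≠ 0 := fun w hw t h => by
    have := congrArg re h
    simp at this
    exact hw (by linarith)
  refine differentiableOn_intervalIntegral_of_continuousOn
    (isOpen_ne_fun continuous_re continuous_const) hr ?_ fun t ht w hw => ?_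
  · refine (hu.comp continuousOn_snd fun p hp => hp.2).mul
      (ContinuousOn.inv₀ (by fun_prop) fun p hp => hne _ hp.1 _)
  · exact (((differentiableAt_id (x := w)).sub_const (z + I * t)).fun_inv (hne w hw t)).const_mul _
      |>.differentiableWithinAt

/-- The jump of the Cauchy integral of a continuous function across a vertical segment. -/
theorem tendsto_cauchy_vertical_jump {u : ℝ → ℂ} {r t₀ : ℝ} (hu : ContinuousOn u (Icc (-r) r))
    (ht₀ : t₀ ∈ Ioo (-r) r) (z : ℂ) :
    Tendsto (fun c : ℝ => (∫ t in -r..r, u t * (z + I * t₀ + (c : ℂ)⁻¹ - (z + I * t))⁻¹) -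
      ∫ t in -r..r, u t * (z + I * t₀ - (c : ℂ)⁻¹ - (z + I * t))⁻¹) atTop
      (𝓝 (2 * Real.pi * u t₀)) := by
  have hr : -r ≤ r := ht₀.1.le.trans ht₀.2.le
  refine (tendsto_cauchy_kernel_jump hu ht₀).congr' ?_
  filter_upwards [eventually_gt_atTop 0] with c hc
  have hne : ∀ w : ℂ, w.re ≠ z.re → IntervalIntegrable
      (fun t : ℝ => u t * (w - (z + I * t))⁻¹) volume (-r) r := fun w hw => by
    refine ContinuousOn.intervalIntegrable_of_Icc hr (hu.mul
      (ContinuousOn.inv₀ (by fun_prop) fun t ht h => hw ?_))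
    have := congrArg re h
    simp at this
    linarith
  have hc' : (c : ℂ)⁻¹.re ≠ 0 := by
    rw [← ofReal_inv, ofReal_re]; positivity
  rw [← intervalIntegral.integral_sub (hne _ (by simpa using hc')) (hne _ (by simpa using hc'))]
  refine intervalIntegral.integral_congr fun t _ => ?_
  rw [mul_sub]
  congr 3 <;> ring

/-- A function holomorphic on a horizontal strip that is, near infinity, a difference of Cauchy
integrals over two vertical segments on the same line forces the densities to agree at common points
of the segments in the strip. -/
theorem eq_of_eq_cauchy_vertical_sub {F : ℂ → ℂ} {u u' : ℝ → ℂ} {r a A : ℝ}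
    (hF : DifferentiableOn ℂ F {w | |w.im| < a})
    (hu : ContinuousOn u (Icc (-r) r)) (hu' : ContinuousOn u' (Icc (-r) r)) {z z' : ℂ}
    (hFC : ∀ w : ℂ, |w.im| < a → A < ‖w‖ → F w =
      (∫ t in -r..r, u t * (w - (z + I * t))⁻¹) - ∫ t in -r..r, u' t * (w - (z' + I * t))⁻¹)
    {t t' : ℝ} (ht : t ∈ Ioo (-r) r) (ht' : t' ∈ Ioo (-r) r)
    (hzt : z + I * t = z' + I * t') (him : |(z + I * t).im| < a) : u t = u' t' := by
  have hr : -r ≤ r := ht.1.le.trans ht.2.le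
  have hre : z'.re = z.re := by
    have := congrArg re hzt
    simpa using this.symm
  have ha : 0 < a := (abs_nonneg _).trans_lt him
  have hSo : IsOpen {w : ℂ | |w.im| < a} :=
    isOpen_lt (continuous_abs.comp continuous_im) continuous_const
  set D : ℂ → ℂ := fun w =>
    (∫ t in -r..r, u t * (w - (z + I * t))⁻¹) - ∫ t in -r..r, u' t * (w - (z' + I * t))⁻¹ with hD
  have hDd : DifferentiableOn ℂ D {w | w.re ≠ z.re} :=
    (differentiableOn_cauchy_vertical hr hu z).sub
      (by simpa [hre] using differentiableOn_cauchy_vertical hr hu' z')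
  have key : ∀ J : Set ℝ, IsOpen J → Convex ℝ J → z.re ∉ J → (∃ x₀ ∈ J, A < |x₀|) →
      EqOn F D (J ×ℂ Ioo (-a) a) := by
    rintro J hJ hJc hz ⟨x₀, hx₀, hAx⟩
    have hsub : J ×ℂ Ioo (-a) a ⊆ {w : ℂ | |w.im| < a} := fun w hw => abs_lt.2 hw.2
    have hsub' : J ×ℂ Ioo (-a) a ⊆ {w : ℂ | w.re ≠ z.re} := fun w hw h => hz (h ▸ hw.1)
    have hopen : IsOpen (J ×ℂ Ioo (-a) a) := hJ.reProdIm isOpen_Ioo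
    have hmem : (x₀ : ℂ) ∈ J ×ℂ Ioo (-a) a := ⟨by simpa using hx₀, by simpa using ha⟩
    refine ((hF.mono hsub).analyticOnNhd hopen).eqOn_of_preconnected_of_eventuallyEq
      ((hDd.mono hsub').analyticOnNhd hopen)
      ((hJc.linear_preimage reLm).inter
        ((convex_Ioo _ _).linear_preimage imLm)).isPreconnected hmem ?_
    have h1 : ∀ᶠ w : ℂ in 𝓝 (x₀ : ℂ), A < ‖w‖ :=
      continuous_norm.continuousAt.eventually_const_lt (by simpa using hAx)
    filter_upwards [h1, hopen.mem_nhds hmem] with w hw hw'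
    exact hFC w (hsub hw') hw
  have hneg : EqOn F D (Iio z.re ×ℂ Ioo (-a) a) :=
    key _ isOpen_Iio (convex_Iio _) (by simp)
      ⟨-(|A| + |z.re| + 1), by rw [mem_Iio]; linarith [neg_abs_le z.re, abs_nonneg A], by
        rw [abs_neg]; linarith [le_abs_self (|A| + |z.re| + 1), le_abs_self A, abs_nonneg z.re]⟩
  have hpos : EqOn F D (Ioi z.re ×ℂ Ioo (-a) a) :=
    key _ isOpen_Ioi (convex_Ioi _) (by simp)
      ⟨|A| + |z.re| + 1, by rw [mem_Ioi]; linarith [le_abs_self z.re, abs_nonneg A], by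
        linarith [le_abs_self (|A| + |z.re| + 1), le_abs_self A, abs_nonneg z.re]⟩
  have hlim0 : Tendsto (fun c : ℝ => (c : ℂ)⁻¹) atTop (𝓝 0) := by
    have := (continuous_ofReal.tendsto 0).comp (tendsto_inv_atTop_zero (𝕜 := ℝ))
    simpa [Function.comp_def] using this
  have hFc : ContinuousAt F (z + I * t) := (hF.differentiableAt (hSo.mem_nhds him)).continuousAt
  have hlimF : Tendsto (fun c : ℝ => F (z + I * t + (c : ℂ)⁻¹) - F (z + I * t - (c : ℂ)⁻¹)) atTop
      (𝓝 0) := by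
    have h1 := hFc.tendsto.comp (f := fun c : ℝ => z + I * t + (c : ℂ)⁻¹)
      (by simpa using hlim0.const_add (z + I * t))
    have h2 := hFc.tendsto.comp (f := fun c : ℝ => z + I * t - (c : ℂ)⁻¹)
      (by simpa using hlim0.const_sub (z + I * t))
    simpa using h1.sub h2
  have hlimD := (tendsto_cauchy_vertical_jump hu ht z).sub (tendsto_cauchy_vertical_jump hu' ht' z')
  have heq := tendsto_nhds_unique (hlimF.congr' ?_) hlimD
  · have hpi : (2 * Real.pi : ℂ) ≠ 0 := by
      exact_mod_cast (by positivity : (2 * Real.pi : ℝ) ≠ 0)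
    rw [← mul_sub, eq_comm, mul_eq_zero, or_iff_right hpi, sub_eq_zero] at heq
    exact heq
  · filter_upwards [eventually_gt_atTop 0] with c hc
    have hc' : 0 < c⁻¹ := inv_pos.2 hc
    have him' := abs_lt.1 him
    simp only [add_im, mul_im, I_re, I_im, ofReal_re, ofReal_im] at him'
    rw [← ofReal_inv, hpos (x := z + I * t + (c⁻¹ : ℝ)) (by
        constructor <;> simp [hc]; constructor <;> linarith),
      hneg (x := z + I * t - (c⁻¹ : ℝ)) (by
        constructor <;> simp [hc]; constructor <;> linarith)]
    simp only [hD, ← hzt]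
    ring

/-- Let `G · t` be holomorphic in the symmetric domain `Ω` with boundary values `f (· + I * t)`.
Then `G` only depends on the point `z + I * t` as long as this point is close to the real axis. -/
theorem eq_of_add_eq_of_abs_im_lt {Ω : Set ℂ} {f : ℂ → ℂ} {G : ℂ → ℝ → ℂ} {r m : ℝ} {K : Set ℂ}
    (ho : IsOpen Ω) (hc : IsPreconnected Ω) (hb : Bornology.IsBounded Ω) (hs : conj ⁻¹' Ω = Ω)
    (hKc : IsCompact K) (hK : ∀ ζ ∈ frontier Ω, ∀ t ∈ Icc (-r) r, ζ + I * t ∈ K)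
    (hf : ContinuousOn f K)
    (hGc : ContinuousOn (fun p : ℂ × ℝ => G p.1 p.2) (closure Ω ×ˢ Icc (-r) r))
    (hGd : ∀ t ∈ Icc (-r) r, DifferentiableOn ℂ (fun z => G z t) Ω)
    (hGf : ∀ ζ ∈ frontier Ω, ∀ t ∈ Icc (-r) r, G ζ t = f (ζ + I * t))
    (hm : ∀ ζ ∈ closure Ω, |ζ.im| ≤ m) (hmr : m < r) {z z' : ℂ} (hz : z ∈ Ω) (hz' : z' ∈ Ω)
    {t t' : ℝ} (ht : t ∈ Ioo (-r) r) (ht' : t' ∈ Ioo (-r) r) (hzt : z + I * t = z' + I * t')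
    (him : |(z + I * t).im| < r - m) : G z t = G z' t' := by
  have hr : -r ≤ r := ht.1.le.trans ht.2.le
  have hm0 : 0 ≤ m := (abs_nonneg _).trans (hm z (subset_closure hz))
  obtain ⟨R₁, hR₁⟩ := hKc.isBounded.exists_norm_le
  obtain ⟨R₂, hR₂⟩ := hb.closure.exists_norm_le
  obtain ⟨M₀, hM₀⟩ := hKc.exists_bound_of_continuousOn hf
  set M := |M₀|
  have hM : ∀ p ∈ K, ‖f p‖ ≤ M := fun p hp => (hM₀ p hp).trans (le_abs_self _)
  have hM0 : 0 ≤ M := abs_nonneg _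
  set R := max R₁ (R₂ + r)
  have hKR : ∀ p ∈ K, ‖p‖ ≤ R := fun p hp => (hR₁ p hp).trans (le_max_left _ _)
  have hΩR : ∀ ζ ∈ closure Ω, ∀ t ∈ Icc (-r) r, ‖ζ + I * (t : ℝ)‖ ≤ R := fun ζ hζ t ht => by
    refine le_trans ?_ (le_max_right _ _)
    refine (norm_add_le _ _).trans (add_le_add (hR₂ ζ hζ) ?_)
    simpa using abs_le.2 ht
  set Q : Set ℂ := closedBall 0 R ∩ {p | r - m ≤ |p.im|}
  have hQc : IsCompact Q := (isCompact_closedBall 0 R).inter_right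
    (isClosed_le continuous_const (continuous_abs.comp continuous_im))
  have : CompactSpace Q := isCompact_iff_compactSpace.1 hQc
  have hRR : closedBall (0 : ℂ) R ⊆ ball 0 (R + 1) := closedBall_subset_ball (by linarith)
  have hQR : Q ⊆ ball 0 (R + 1) := inter_subset_left.trans hRR
  have hΩB : ∀ ζ ∈ closure Ω, ∀ t ∈ Icc (-r) r, ζ + I * (t : ℝ) ∈ ball (0 : ℂ) (R + 1) :=
    fun ζ hζ t ht => hRR (by simpa using hΩR ζ hζ t ht)
  let V : Submodule ℂ (ℂ → ℂ) :=
    { carrier := {E | DifferentiableOn ℂ E (ball 0 (R + 1))}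
      add_mem' := fun h h' => h.add h'
      zero_mem' := differentiableOn_const 0
      smul_mem' := fun c _ h => h.const_smul c }
  have hcont : ∀ E ∈ V, ContinuousOn (fun p : ℂ × ℝ => G p.1 p.2 * E (p.1 + I * p.2))
      (closure Ω ×ˢ Icc (-r) r) := fun E hE => hGc.mul
    (hE.continuousOn.comp (f := fun p : ℂ × ℝ => p.1 + I * p.2) (by fun_prop)
      fun p hp => hΩB p.1 hp.1 p.2 hp.2)
  have hint : ∀ E ∈ V, ∀ ζ ∈ closure Ω,
      IntervalIntegrable (fun t : ℝ => G ζ t * E (ζ + I * t)) volume (-r) r := fun E hE ζ hζ =>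
    ((hcont E hE).comp (f := fun t : ℝ => ((ζ, t) : ℂ × ℝ)) (by fun_prop)
      fun t ht => ⟨hζ, ht⟩).intervalIntegrable_of_Icc hr
  have hHd : ∀ E ∈ V, DiffContOnCl ℂ (fun ζ => ∫ t in -r..r, G ζ t * E (ζ + I * t)) Ω :=
    fun E hE => diffContOnCl_intervalIntegral ho hr (hcont E hE) fun t ht =>
      (hGd t ht).mul (DifferentiableOn.comp hE (by fun_prop)
        fun ζ hζ => hΩB ζ (subset_closure hζ) t ht)
  let ρ : V →ₗ[ℂ] C(Q, ℂ) :=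
    { toFun := fun E => ⟨Q.domRestrict E.1, (E.2.continuousOn.mono hQR).domRestrict⟩
      map_add' := fun _ _ => rfl
      map_smul' := fun _ _ => rfl }
  let ev (ζ : ℂ) (hζ : ζ ∈ Ω) : V →ₗ[ℂ] ℂ :=
    { toFun := fun E => ∫ t in -r..r, G ζ t * E.1 (ζ + I * t)
      map_add' := fun E E' => by
        rw [← intervalIntegral.integral_add (hint _ E.2 ζ (subset_closure hζ))
          (hint _ E'.2 ζ (subset_closure hζ))]
        exact intervalIntegral.integral_congr fun t _ => mul_add _ _ _
      map_smul' := fun c E => by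
        rw [RingHom.id_apply, smul_eq_mul, ← intervalIntegral.integral_const_mul]
        exact intervalIntegral.integral_congr fun t _ => mul_left_comm _ _ _ }
  obtain ⟨C, hC⟩ := exists_norm_sub_le_of_norm_sub_conj_le ho hc hb hs hz hz'
  have hfr : ∀ ζ ∈ frontier Ω, conj ζ ∈ frontier Ω := fun ζ hζ => by
    have h1 := conjCLE.toHomeomorph.preimage_frontier Ω
    have h2 : conjCLE.toHomeomorph ⁻¹' Ω = Ω := hs
    rw [h2] at h1
    exact h1.symm.subset hζ
  obtain ⟨L, hL⟩ := exists_strongDual_comp_eq ρ (ev z hz - ev z' hz') (C * (4 * m * M)) fun E => by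
    refine le_of_forall_pos_le_add fun δ hδ => ?_
    have hη : 0 < δ / (|C| + 1) := by positivity
    refine (hC _ (hHd E.1 E.2) (4 * m * (M * ‖ρ E‖) + δ / (|C| + 1)) (by positivity)
      fun ζ hζ => ?_).trans ?_
    · refine (norm_integral_sub_integral_conj_le hK hf
        (E.2.continuousOn.mono fun p hp => hRR (by simpa using hKR p hp)) hGf hmr hM
        (B := ‖ρ E‖) (fun p hp hp' => ?_) hζ (hfr ζ hζ)
        (hm ζ (frontier_subset_closure hζ))).trans (le_add_of_nonneg_right hη.le)
      exact (ρ E).norm_coe_le_norm ⟨p, by simpa using hKR p hp, hp'⟩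
    · have h1 : C * (δ / (|C| + 1)) ≤ δ := by
        rw [← mul_div_assoc, div_le_iff₀ (by positivity)]
        nlinarith [le_abs_self C]
      linarith
  obtain ⟨F, hF, hFL⟩ := exists_differentiableOn_compl_cauchy_transform hQc L
  refine eq_of_eq_cauchy_vertical_sub (F := F) (u := G z) (u' := G z') (z := z) (z' := z')
    (a := r - m) (A := R + 1) (hF.mono fun w (hw : |w.im| < r - m) hw' => hw.not_ge hw'.2)
    ?_ ?_ ?_ ht ht' hzt him
  · exact hGc.comp (f := fun t : ℝ => ((z, t) : ℂ × ℝ)) (by fun_prop)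
      fun t ht => ⟨subset_closure hz, ht⟩
  · exact hGc.comp (f := fun t : ℝ => ((z', t) : ℂ × ℝ)) (by fun_prop)
      fun t ht => ⟨subset_closure hz', ht⟩
  · intro w hw hwR
    have hE : (fun p => (w - p)⁻¹) ∈ V := fun p hp => by
      refine (((differentiableAt_id (x := p)).const_sub w).fun_inv
        (sub_ne_zero.2 ?_)).differentiableWithinAt
      rintro rfl
      exact hwR.not_gt (by simpa using hp)
    rw [hFL w (fun h => hw.not_ge h.2) (ρ ⟨_, hE⟩) fun p => rfl, hL]
    rfl

/-- A family of functions holomorphic in a bounded set and continuous up to the boundary is jointly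
continuous if its boundary values are. -/
theorem continuousOn_uncurry_of_continuousOn_frontier {G : ℂ → ℝ → ℂ} {Ω : Set ℂ} {T : Set ℝ}
    (hb : Bornology.IsBounded Ω) (hT : IsCompact T)
    (hG : ∀ t ∈ T, DiffContOnCl ℂ (fun z => G z t) Ω)
    (hc : ContinuousOn (fun p : ℂ × ℝ => G p.1 p.2) (frontier Ω ×ˢ T)) :
    ContinuousOn (fun p : ℂ × ℝ => G p.1 p.2) (closure Ω ×ˢ T) := by
  have hfc : IsCompact (frontier Ω) :=
    hb.isCompact_closure.of_isClosed_subset isClosed_frontier frontier_subset_closure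
  have huc := (hfc.prod hT).uniformContinuousOn_of_continuous hc
  rw [Metric.uniformContinuousOn_iff] at huc
  rintro ⟨z₀, t₀⟩ ⟨hz₀, ht₀⟩
  rw [Metric.continuousWithinAt_iff]
  intro ε hε
  obtain ⟨δ₁, hδ₁, h₁⟩ := huc (ε / 2) (half_pos hε)
  obtain ⟨δ₂, hδ₂, h₂⟩ := Metric.continuousWithinAt_iff.1 ((hG t₀ ht₀).continuousOn z₀ hz₀)
    (ε / 2) (half_pos hε)
  refine ⟨min δ₁ δ₂, lt_min hδ₁ hδ₂, ?_⟩
  rintro ⟨z, t⟩ ⟨hz, ht⟩ hd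
  rw [Prod.dist_eq, max_lt_iff, lt_min_iff, lt_min_iff] at hd
  have h3 : ‖G z t - G z t₀‖ ≤ ε / 2 := by
    refine norm_le_of_forall_mem_frontier_norm_le (f := fun z => G z t - G z t₀) hb
      ((hG t ht).sub (hG t₀ ht₀)) (fun ζ hζ => ?_) hz
    have := h₁ (ζ, t) ⟨hζ, ht⟩ (ζ, t₀) ⟨hζ, ht₀⟩ (by
      rw [Prod.dist_eq, dist_self]; exact max_lt hδ₁ hd.2.1)
    rw [← dist_eq_norm]
    exact this.le
  have h4 : dist (G z t₀) (G z₀ t₀) < ε / 2 := h₂ hz hd.1.2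
  rw [← dist_eq_norm] at h3
  calc dist (G z t) (G z₀ t₀) ≤ dist (G z t) (G z t₀) + dist (G z t₀) (G z₀ t₀) :=
        dist_triangle _ _ _
    _ < ε := by linarith

/-- A bounded connected symmetric set `Ω` for which `Ω̄ - ir` and `Ω̄ + ir` are disjoint has
half-height `m < r`, and each intermediate translate of `Ω` comes within `r - m` of the real
axis. -/
theorem exists_abs_im_le_of_disjoint {Ω : Set ℂ} {r : ℝ} (hr : 0 < r) (hc : IsConnected Ω)
    (hb : Bornology.IsBounded Ω) (hs : ∀ ζ ∈ closure Ω, conj ζ ∈ closure Ω)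
    (hdisj : ∀ ζ ∈ closure Ω, ∀ ζ' ∈ closure Ω, ζ - I * r ≠ ζ' + I * r) :
    ∃ m < r, (∀ ζ ∈ closure Ω, |ζ.im| ≤ m) ∧
      ∀ t ∈ Ioo (-r) r, ∃ z ∈ Ω, |(z + I * (t : ℝ)).im| < r - m := by
  obtain ⟨p, hp, hpm⟩ := hb.isCompact_closure.exists_isMaxOn hc.nonempty.closure
    continuous_im.continuousOn
  have hmax : ∀ ζ ∈ closure Ω, ζ.im ≤ p.im := fun ζ hζ => hpm hζ
  have hmin : ∀ ζ ∈ closure Ω, -p.im ≤ ζ.im := fun ζ hζ => by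
    have := hmax _ (hs ζ hζ)
    rw [conj_im] at this
    linarith
  have hconn : (im '' closure Ω).OrdConnected :=
    (hc.closure.isPreconnected.image _ continuous_im.continuousOn).ordConnected
  have hIcc : ∀ y ∈ Icc (-p.im) p.im, ∃ ζ ∈ closure Ω, ζ.im = y := fun y hy =>
    hconn.out ⟨conj p, hs p hp, conj_im p⟩ ⟨p, hp, rfl⟩ hy
  have hp0 : 0 ≤ p.im := by linarith [hmin p hp]
  have hpr : p.im < r := by
    by_contra! h
    obtain ⟨ζ, hζ, hζr⟩ := hIcc r ⟨by linarith, h⟩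
    refine hdisj ζ hζ _ (hs ζ hζ) (Complex.ext (by simp) ?_)
    simp [hζr]
  refine ⟨p.im, hpr, fun ζ hζ => abs_le.2 ⟨hmin ζ hζ, hmax ζ hζ⟩, fun t ht => ?_⟩
  obtain ⟨ζ, hζ, hζt⟩ : ∃ ζ ∈ closure Ω, |(ζ + I * (t : ℝ)).im| < r - p.im := by
    obtain ⟨ζ, hζ, h⟩ := hIcc (max (-p.im) (min p.im (-t)))
      ⟨le_max_left _ _, max_le (by linarith) (min_le_left _ _)⟩
    refine ⟨ζ, hζ, ?_⟩
    simp only [add_im, mul_im, I_re, I_im, ofReal_re, ofReal_im, h]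
    rw [abs_lt]
    have := ht.1
    have := ht.2
    rcases max_cases (-p.im) (min p.im (-t)) with h1 | h1 <;>
      rcases min_cases p.im (-t) with h2 | h2 <;> constructor <;> linarith
  obtain ⟨z, hz, hzΩ⟩ := mem_closure_iff.1 hζ {z | |(z + I * (t : ℝ)).im| < r - p.im}
    (isOpen_lt (by fun_prop) continuous_const) hζt
  exact ⟨z, hzΩ, hz⟩

/-- If the holomorphic functions `G · s`, translated by `I * s`, agree locally with `G · t` for `s`
close to `t` near some point of a connected open set, then they do near every point. -/
theorem eventually_eq_translate_of_exists {Ω : Set ℂ} {G : ℂ → ℝ → ℂ} {T : Set ℝ}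
    (ho : IsOpen Ω) (hc : IsPreconnected Ω) (hGd : ∀ s ∈ T, DifferentiableOn ℂ (fun z => G z s) Ω)
    {t : ℝ} (hT : T ∈ 𝓝 t)
    (hne : ∃ z ∈ Ω, ∀ᶠ p : ℝ × ℂ in 𝓝 (t, z), G (p.2 + I * (t - p.1)) p.1 = G p.2 t) :
    ∀ z ∈ Ω, ∀ᶠ p : ℝ × ℂ in 𝓝 (t, z), G (p.2 + I * (t - p.1)) p.1 = G p.2 t := by
  set u : Set ℂ := {z | ∀ᶠ p : ℝ × ℂ in 𝓝 (t, z), G (p.2 + I * (t - p.1)) p.1 = G p.2 t}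
  have huo : IsOpen u := isOpen_setOfPred_eventually_nhds.preimage
    (f := fun z : ℂ => ((t, z) : ℝ × ℂ)) (by fun_prop)
  refine hc.subset_of_closure_inter_subset huo hne ?_
  rintro z ⟨hzu, hz⟩
  obtain ⟨ρ, hρ, hball⟩ := Metric.isOpen_iff.1 ho z hz
  obtain ⟨z₁, hz₁, hz₁u⟩ := mem_closure_iff.1 hzu (ball z (ρ / 2)) isOpen_ball
    (mem_ball_self (half_pos hρ))
  change ∀ᶠ p : ℝ × ℂ in 𝓝 (t, z₁), G (p.2 + I * (t - p.1)) p.1 = G p.2 t at hz₁u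
  rw [nhds_prod_eq, eventually_prod_iff] at hz₁u
  obtain ⟨A, hA, B, hB, hAB⟩ := hz₁u
  have hsmall : ∀ᶠ s in 𝓝 t, s ∈ T ∧ |t - s| < ρ / 2 ∧ A s := by
    have h1 : ∀ᶠ s in 𝓝 t, |t - s| < ρ / 2 := by
      filter_upwards [Metric.ball_mem_nhds t (half_pos hρ)] with s hs
      rwa [mem_ball, dist_comm, Real.dist_eq] at hs
    filter_upwards [hT, h1, hA] with s h2 h3 h4 using ⟨h2, h3, h4⟩
  have hmem : ∀ᶠ z' in 𝓝 z, z' ∈ ball z (ρ / 2) := ball_mem_nhds z (half_pos hρ)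
  refine (nhds_prod_eq (x := t) (y := z) ▸ (hsmall.prod_mk hmem)).mono ?_
  rintro ⟨s, z'⟩ ⟨⟨hsT, hs, hsA⟩, hz'⟩
  have hsub : ball z (ρ / 2) ⊆ Ω := (ball_subset_ball (by linarith)).trans hball
  have hmaps : MapsTo (fun w : ℂ => w + I * (t - s)) (ball z (ρ / 2)) Ω := fun w hw => by
    apply hball
    rw [mem_ball, dist_eq_norm] at hw ⊢
    calc ‖w + I * (t - s) - z‖ = ‖(w - z) + I * ((t - s : ℝ) : ℂ)‖ := by push_cast; ring_nf
      _ ≤ ‖w - z‖ + |t - s| := (norm_add_le _ _).trans_eq (by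
          rw [norm_mul, norm_I, one_mul, norm_real, Real.norm_eq_abs])
      _ < ρ := by linarith
  refine (((hGd s hsT).comp (by fun_prop) hmaps).analyticOnNhd
    isOpen_ball).eqOn_of_preconnected_of_eventuallyEq
    (((hGd t (mem_of_mem_nhds hT)).mono hsub).analyticOnNhd isOpen_ball)
    (convex_ball _ _).isPreconnected hz₁ ?_ hz'
  filter_upwards [hB] with w hw using hAB hsA hw

/-- A family that is locally constant along the translates of a point inside `Ω` keeps its value
until the translate leaves `Ω`, so that it is determined by the boundary values. -/
theorem eq_of_eventually_eq_translate {Ω : Set ℂ} {f : ℂ → ℂ} {G : ℂ → ℝ → ℂ} {r : ℝ}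
    (ho : IsOpen Ω)
    (hGc : ContinuousOn (fun p : ℂ × ℝ => G p.1 p.2) (closure Ω ×ˢ Icc (-r) r))
    (hGf : ∀ ζ ∈ frontier Ω, ∀ t ∈ Icc (-r) r, G ζ t = f (ζ + I * t))
    (hloc : ∀ t ∈ Ioo (-r) r, ∀ z ∈ Ω,
      ∀ᶠ p : ℝ × ℂ in 𝓝 (t, z), G (p.2 + I * (t - p.1)) p.1 = G p.2 t)
    {z : ℂ} (hz : z ∈ Ω) {t : ℝ} (σ : ℝ)
    (hσ : ∀ v ≥ 0, z - I * (σ * v : ℝ) ∈ closure Ω → t + σ * v ∈ Ioo (-r) r)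
    (hex : ∃ v ≥ 0, z - I * (σ * v : ℝ) ∉ Ω) : G z t = f (z + I * t) := by
  set S : Set ℝ := Ici 0 ∩ {v | z - I * (σ * v : ℝ) ∉ Ω}
  have hSc : IsClosed S := isClosed_Ici.inter
    (ho.isClosed_compl.preimage (f := fun v : ℝ => z - I * (σ * v : ℝ)) (by fun_prop))
  have hSb : BddBelow S := ⟨0, fun v hv => hv.1⟩
  set b := sInf S
  have hbS : b ∈ S := hSc.csInf_mem hex hSb
  have hb0 : 0 ≤ b := hbS.1
  have hin : ∀ v ∈ Ico 0 b, z - I * (σ * v : ℝ) ∈ Ω := fun v hv => by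
    by_contra h
    exact (csInf_le hSb ⟨hv.1, h⟩).not_gt hv.2
  have hb' : 0 < b := by
    refine hb0.lt_of_ne fun h => hbS.2 ?_
    rw [← h]
    simpa using hz
  have hcl : ∀ v ∈ Icc 0 b, z - I * (σ * v : ℝ) ∈ closure Ω := fun v hv => by
    have h1 : v ∈ closure (Ico 0 b) := by rwa [closure_Ico hb'.ne]
    exact map_mem_closure (f := fun v : ℝ => z - I * (σ * v : ℝ)) (by fun_prop) h1 hin
  have hIoo : ∀ v ∈ Icc 0 b, t + σ * v ∈ Ioo (-r) r := fun v hv => hσ v hv.1 (hcl v hv)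
  have hcont : ContinuousOn (fun v : ℝ => G (z - I * (σ * v : ℝ)) (t + σ * v)) (Icc 0 b) :=
    hGc.comp (f := fun v : ℝ => ((z - I * (σ * v : ℝ), t + σ * v) : ℂ × ℝ)) (by fun_prop)
      fun v hv => ⟨hcl v hv, Ioo_subset_Icc_self (hIoo v hv)⟩
  have hconst := constant_of_has_deriv_right_zero hcont (fun v hv => by
    have h1 := hloc _ (hIoo v (Ico_subset_Icc_self hv)) _ (hin v hv)
    have h2 : Tendsto (fun w : ℝ => ((t + σ * w, z - I * (σ * v : ℝ)) : ℝ × ℂ)) (𝓝 v)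
        (𝓝 (t + σ * v, z - I * (σ * v : ℝ))) :=
      Continuous.tendsto (by fun_prop) v
    refine ((hasDerivAt_const v (G (z - I * (σ * v : ℝ)) (t + σ * v))).congr_of_eventuallyEq
      ((h2.eventually h1).mono fun w hw => ?_)).hasDerivWithinAt
    simp only at hw
    rw [← hw]
    congr 1
    push_cast
    ring) b ⟨hb0, le_rfl⟩
  have hfr : z - I * (σ * b : ℝ) ∈ frontier Ω := by
    rw [ho.frontier_eq]
    exact ⟨hcl b ⟨hb0, le_rfl⟩, hbS.2⟩
  rw [hGf _ hfr _ (Ioo_subset_Icc_self (hIoo b ⟨hb0, le_rfl⟩))] at hconst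
  simp only [mul_zero, ofReal_zero, sub_zero, add_zero] at hconst
  rw [← hconst]
  congr 1
  push_cast
  ring

/-- Points of a simple closed curve close to `γ s₀` have parameters close to `s₀`. -/
theorem eventually_exists_mem_Icc_of_mem_range {γ : ℝ → ℂ} {p : ℝ} (hp : 0 < p)
    (hc : Continuous γ) (hper : Function.Periodic γ p) (hinj : InjOn γ (Ico 0 p)) (s₀ : ℝ) {δ : ℝ}
    (hδ : 0 < δ) : ∀ᶠ w in 𝓝 (γ s₀), w ∈ range γ → ∃ s ∈ Icc (s₀ - δ) (s₀ + δ), γ s = w := by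
  have hC : IsCompact (γ '' Icc (s₀ + δ) (s₀ - δ + p)) := isCompact_Icc.image hc
  have hmem : γ s₀ ∉ γ '' Icc (s₀ + δ) (s₀ - δ + p) := by
    rintro ⟨s, hs, hss⟩
    have h1 : ∀ a, γ (toIcoMod hp 0 a) = γ a := fun a => hper.sub_zsmul_eq _
    have h2 : toIcoMod hp 0 s = toIcoMod hp 0 s₀ := by
      refine hinj ?_ ?_ (by rw [h1, h1, hss])
      · simpa using toIcoMod_mem_Ico hp 0 s
      · simpa using toIcoMod_mem_Ico hp 0 s₀
    rw [toIcoMod_eq_toIcoMod] at h2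
    obtain ⟨n, hn⟩ := h2
    rw [zsmul_eq_mul] at hn
    have h3 : -1 < (n : ℝ) := by
      by_contra! h
      nlinarith [hs.1, hs.2]
    have h4 : (n : ℝ) < 0 := by
      by_contra! h
      nlinarith [hs.1, hs.2]
    have h5 : -1 < n := by exact_mod_cast h3
    have h6 : n < 0 := by exact_mod_cast h4
    omega
  filter_upwards [hC.isClosed.isOpen_compl.mem_nhds hmem]
  rintro _ hw ⟨a, rfl⟩
  have h1 := toIcoMod_mem_Ico hp (s₀ - δ) a
  have h2 : γ (toIcoMod hp (s₀ - δ) a) = γ a := by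
    rw [toIcoMod]
    exact hper.sub_zsmul_eq _
  refine ⟨_, ⟨h1.1, ?_⟩, h2⟩
  by_contra! h
  exact hw ⟨_, ⟨h.le, h1.2.le⟩, h2⟩

/-- A bounded domain whose frontier is a simple closed curve contains points arbitrarily close to
and on the same vertical line as any frontier point at which the tangent is not vertical. -/
theorem exists_mem_re_eq_of_frontier {Ω : Set ℂ} (ho : IsOpen Ω) {γ : ℝ → ℂ} {p : ℝ} (hp : 0 < p)
    (hc : Continuous γ) (hper : Function.Periodic γ p) (hinj : InjOn γ (Ico 0 p))
    (hrange : range γ = frontier Ω) {s₀ : ℝ} {v : ℂ} (hd : HasStrictDerivAt γ v s₀)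
    (hv : v.re ≠ 0) {η : ℝ} (hη : 0 < η) :
    ∃ z ∈ Ω, z.re = (γ s₀).re ∧ ‖z - γ s₀‖ < η := by
  set Ψ : ℝ × ℝ → ℂ := fun q => γ q.1 + I * q.2 with hΨ
  let A : ℝ × ℝ →L[ℝ] ℂ := (ContinuousLinearMap.fst ℝ ℝ ℝ).smulRight v +
    (ContinuousLinearMap.snd ℝ ℝ ℝ).smulRight I
  have hΨd : HasStrictFDerivAt Ψ A (s₀, 0) := by
    have h1 : HasStrictFDerivAt (fun q : ℝ × ℝ => γ q.1)
        ((ContinuousLinearMap.fst ℝ ℝ ℝ).smulRight v) (s₀, 0) :=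
      (hd.hasStrictFDerivAt.comp (s₀, 0) hasStrictFDerivAt_fst).congr_fderiv (by ext <;> simp)
    have h2 : HasStrictFDerivAt (fun q : ℝ × ℝ => I * q.2)
        ((ContinuousLinearMap.snd ℝ ℝ ℝ).smulRight I) (s₀, 0) := by
      refine (((ContinuousLinearMap.snd ℝ ℝ ℝ).smulRight I).hasStrictFDerivAt
        (x := ((s₀, 0) : ℝ × ℝ))).congr_of_eventuallyEq (Eventually.of_forall fun q => ?_)
      simp [mul_comm]
    exact h1.add h2
  have hAinj : Function.Injective A := by
    rw [injective_iff_map_eq_zero]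
    rintro ⟨a, b⟩ h
    have h1 := congrArg re h
    have h2 := congrArg im h
    simp [A, hv] at h1 h2
    subst h1
    simpa using h2
  let e : (ℝ × ℝ) ≃L[ℝ] ℂ := (LinearEquiv.ofInjectiveOfFinrankEq A.toLinearMap hAinj
    (by simp)).toContinuousLinearEquiv
  have he : (e : ℝ × ℝ →L[ℝ] ℂ) = A := by
    ext <;> rfl
  have hΨe : HasStrictFDerivAt Ψ (e : ℝ × ℝ →L[ℝ] ℂ) (s₀, 0) := he ▸ hΨd
  have hΨ0 : Ψ (s₀, 0) = γ s₀ := by simp [hΨ]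
  have hΨc : Continuous Ψ := by fun_prop
  set φ := hΨe.toOpenPartialHomeomorph Ψ
  have hsrc : φ.source ∈ 𝓝 ((s₀, 0) : ℝ × ℝ) :=
    φ.open_source.mem_nhds hΨe.mem_toOpenPartialHomeomorph_source
  have hΨinj : InjOn Ψ φ.source := φ.injOn
  obtain ⟨δ, hδ, hδs⟩ : ∃ δ > 0, ∀ s ∈ Icc (s₀ - δ) (s₀ + δ), ((s, 0) : ℝ × ℝ) ∈ φ.source := by
    have h1 : ∀ᶠ s in 𝓝 s₀, ((s, 0) : ℝ × ℝ) ∈ φ.source :=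
      (Continuous.tendsto (f := fun s : ℝ => ((s, 0) : ℝ × ℝ)) (by fun_prop) s₀).eventually hsrc
    obtain ⟨δ, hδ, h⟩ := Metric.nhds_basis_closedBall.eventually_iff.1 h1
    exact ⟨δ, hδ, fun s hs => h (by rwa [Real.closedBall_eq_Icc])⟩
  have hgood : ∀ᶠ q in 𝓝 ((s₀, 0) : ℝ × ℝ), Ψ q ∈ frontier Ω → q.2 = 0 := by
    have h1 := (hΨ0 ▸ hΨc.tendsto (s₀, 0)).eventually
      (eventually_exists_mem_Icc_of_mem_range hp hc hper hinj s₀ hδ)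
    filter_upwards [hsrc, h1] with q hq h2 h3
    obtain ⟨s, hs, hsq⟩ := h2 (hrange ▸ h3)
    have := hΨinj (hδs s hs) hq (by simpa [hΨ] using hsq)
    rw [← this]
  obtain ⟨a, ha, hgood'⟩ := Metric.nhds_basis_ball.eventually_iff.1 hgood
  set ε := min a η
  have hε0 : 0 < ε := lt_min ha hη
  have himg : Ψ '' ball (s₀, 0) ε ∈ 𝓝 (γ s₀) := by
    rw [← hΨ0, ← hΨe.map_nhds_eq_of_equiv]
    exact image_mem_map (ball_mem_nhds _ hε0)
  have hfr : γ s₀ ∈ frontier Ω := hrange ▸ mem_range_self s₀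
  obtain ⟨_, ⟨q, hq, rfl⟩, hqΩ⟩ := mem_closure_iff_nhds.1 (frontier_subset_closure hfr) _ himg
  have hbox : ball ((s₀, 0) : ℝ × ℝ) ε = Ioo (s₀ - ε) (s₀ + ε) ×ˢ Ioo (-ε) ε := by
    rw [← ball_prod_same, Real.ball_eq_Ioo, Real.ball_eq_Ioo, zero_sub, zero_add]
  rw [hbox] at hq
  have hdisj : ∀ z ∈ Ω, z ∉ frontier Ω := fun z hz h => by
    rw [ho.frontier_eq] at h
    exact h.2 hz
  have key : ∀ J ⊆ Ioo (-ε) ε, IsPreconnected J → (0 : ℝ) ∉ J → q.2 ∈ J → ∀ τ ∈ J,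
      γ s₀ + I * τ ∈ Ω := by
    intro J hJ hJc hJ0 hqJ τ hτ
    have hS : IsPreconnected (Ψ '' (Ioo (s₀ - ε) (s₀ + ε) ×ˢ J)) :=
      (isPreconnected_Ioo.prod hJc).image _ hΨc.continuousOn
    refine hS.subset_of_closure_inter_subset ho ⟨_, ⟨q, ⟨hq.1, hqJ⟩, rfl⟩, hqΩ⟩ ?_
      ⟨(s₀, τ), ⟨⟨by linarith, by linarith⟩, hτ⟩, rfl⟩
    rintro _ ⟨hcl, q', hq', rfl⟩
    by_contra h
    have h1 : Ψ q' ∈ frontier Ω := by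
      rw [ho.frontier_eq]
      exact ⟨hcl, h⟩
    have h2 : q' ∈ ball ((s₀, 0) : ℝ × ℝ) ε := hbox ▸ ⟨hq'.1, hJ hq'.2⟩
    exact hJ0 (hgood' (ball_subset_ball (min_le_left _ _) h2) h1 ▸ hq'.2)
  have hfin : ∀ τ : ℝ, |τ| < ε → γ s₀ + I * τ ∈ Ω →
      ∃ z ∈ Ω, z.re = (γ s₀).re ∧ ‖z - γ s₀‖ < η := fun τ hτ h =>
    ⟨_, h, by simp, by simpa using hτ.trans_le (min_le_right _ _)⟩
  rcases lt_trichotomy q.2 0 with h | h | h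
  · refine hfin (-(ε / 2)) (by rw [abs_neg, abs_of_pos] <;> linarith)
      (key (Ioo (-ε) 0) (Ioo_subset_Ioo_right hε0.le) isPreconnected_Ioo (by simp)
        ⟨hq.2.1, h⟩ _ ⟨by linarith, by linarith⟩)
  · refine absurd (hrange ▸ mem_range_self q.1) (hdisj (γ q.1) ?_)
    simpa [hΨ, h] using hqΩ
  · refine hfin (ε / 2) (by rw [abs_of_pos] <;> linarith)
      (key (Ioo 0 ε) (Ioo_subset_Ioo_left (by linarith)) isPreconnected_Ioo (by simp)
        ⟨h, hq.2.2⟩ _ ⟨by linarith, by linarith⟩)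

/-- An analytic closed curve bounding a bounded domain has only finitely many vertical tangents up
to periodicity. -/
theorem finite_setOf_re_deriv_eq_zero {Ω : Set ℂ} (ho : IsOpen Ω) (hne : Ω.Nonempty)
    (hb : Bornology.IsBounded Ω) {γ : ℝ → ℂ} (han : ∀ s, AnalyticAt ℝ γ s)
    (hrange : range γ = frontier Ω) (a b : ℝ) : {s ∈ Icc a b | (deriv γ s).re = 0}.Finite := by
  by_contra hinf
  have hcomp : IsCompact (Icc a b) := isCompact_Icc
  obtain ⟨s, -, hacc⟩ := Set.Infinite.exists_accPt_of_subset_isCompact hinf hcomp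
    (fun s hs => hs.1)
  have han' : AnalyticOnNhd ℝ (fun s => (deriv γ s).re) univ := fun s _ =>
    (reCLM.analyticAt _).comp (han s).deriv
  have hfreq : ∃ᶠ w in 𝓝[≠] s, (deriv γ w).re = 0 :=
    (accPt_iff_frequently_nhdsNE.1 hacc).mono fun w hw => hw.2
  have hzero := han'.eqOn_zero_of_preconnected_of_frequently_eq_zero isPreconnected_univ
    (mem_univ s) hfreq
  have hder : ∀ s, HasDerivAt (fun s => (γ s).re) ((deriv γ s).re) s := fun s =>
    reCLM.hasFDerivAt.comp_hasDerivAt s (han s).differentiableAt.hasDerivAt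
  have hconst : ∀ ζ ∈ frontier Ω, ζ.re = (γ 0).re := fun ζ hζ => by
    rw [← hrange] at hζ
    obtain ⟨s, rfl⟩ := hζ
    exact is_const_of_deriv_eq_zero (fun s => (hder s).differentiableAt)
      (fun s => (hder s).deriv.trans (hzero (mem_univ s))) s 0
  have hre : ∀ z ∈ Ω, z.re = (γ 0).re := fun z hz => by
    refine le_antisymm ?_ (neg_le_neg_iff.1 ?_)
    · have := im_le_of_forall_mem_frontier_im_le (P := fun z => I * z) hb
        (Differentiable.diffContOnCl (by fun_prop))
        (fun ζ hζ => by simpa using (hconst ζ hζ).le) (subset_closure hz)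
      simpa using this
    · have := im_le_of_forall_mem_frontier_im_le (P := fun z => -(I * z)) hb
        (Differentiable.diffContOnCl (by fun_prop)) (ε := -(γ 0).re)
        (fun ζ hζ => by simpa using (hconst ζ hζ).ge) (subset_closure hz)
      simpa using this
  obtain ⟨z, hz⟩ := hne
  obtain ⟨ρ, hρ, hball⟩ := Metric.isOpen_iff.1 ho z hz
  have h1 := hre (z + (ρ / 2 : ℝ)) (hball (by
    rw [mem_ball, dist_eq_norm, add_sub_cancel_left, norm_real, Real.norm_eq_abs,
      abs_of_pos (half_pos hρ)]
    linarith))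
  have h2 := hre z hz
  simp only [add_re, ofReal_re] at h1
  linarith

/-- If a continuous function on the vertical translates of the boundary of a symmetric domain
extends holomorphically to each translate of the domain, then it is holomorphic on the union of the
translates of the domain. -/
theorem differentiableAt_add_of_extends_translates {Ω : Set ℂ} {f : ℂ → ℂ} {G : ℂ → ℝ → ℂ}
    {r m : ℝ} {K : Set ℂ} (ho : IsOpen Ω) (hc : IsPreconnected Ω) (hb : Bornology.IsBounded Ω)
    (hs : conj ⁻¹' Ω = Ω) (hKc : IsCompact K)
    (hK : ∀ ζ ∈ frontier Ω, ∀ t ∈ Icc (-r) r, ζ + I * t ∈ K) (hf : ContinuousOn f K)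
    (hGd : ∀ t ∈ Icc (-r) r, DiffContOnCl ℂ (fun z => G z t) Ω)
    (hGf : ∀ ζ ∈ frontier Ω, ∀ t ∈ Icc (-r) r, G ζ t = f (ζ + I * t))
    (hm : ∀ ζ ∈ closure Ω, |ζ.im| ≤ m) (hmr : m < r)
    (hmt : ∀ t ∈ Ioo (-r) r, ∃ z ∈ Ω, |(z + I * (t : ℝ)).im| < r - m)
    {z : ℂ} (hz : z ∈ Ω) {t : ℝ} (ht : t ∈ Ioo (-r) r) : DifferentiableAt ℂ f (z + I * t) := by
  have hGc : ContinuousOn (fun p : ℂ × ℝ => G p.1 p.2) (closure Ω ×ˢ Icc (-r) r) := by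
    refine continuousOn_uncurry_of_continuousOn_frontier hb isCompact_Icc hGd ?_
    exact (hf.comp (f := fun p : ℂ × ℝ => p.1 + I * p.2) (by fun_prop)
      fun p hp => hK p.1 hp.1 p.2 hp.2).congr fun p hp => hGf p.1 hp.1 p.2 hp.2
  have hGd' : ∀ t ∈ Icc (-r) r, DifferentiableOn ℂ (fun z => G z t) Ω := fun t ht =>
    (hGd t ht).differentiableOn
  have hloc : ∀ t ∈ Ioo (-r) r, ∀ z ∈ Ω,
      ∀ᶠ p : ℝ × ℂ in 𝓝 (t, z), G (p.2 + I * (t - p.1)) p.1 = G p.2 t := by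
    intro t ht
    refine eventually_eq_translate_of_exists ho hc hGd' (Icc_mem_nhds ht.1 ht.2) ?_
    obtain ⟨z, hz, hzt⟩ := hmt t ht
    refine ⟨z, hz, ?_⟩
    have h1 : ∀ᶠ p : ℝ × ℂ in 𝓝 (t, z), p.1 ∈ Ioo (-r) r :=
      continuous_fst.continuousAt.eventually_mem (Ioo_mem_nhds ht.1 ht.2)
    have h2 : ∀ᶠ p : ℝ × ℂ in 𝓝 (t, z), p.2 ∈ Ω :=
      continuous_snd.continuousAt.eventually_mem (ho.mem_nhds hz)
    have h3 : ∀ᶠ p : ℝ × ℂ in 𝓝 (t, z), p.2 + I * (t - p.1) ∈ Ω :=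
      ContinuousAt.eventually_mem (f := fun p : ℝ × ℂ => p.2 + I * (t - p.1))
        (Continuous.continuousAt (by fun_prop)) (ho.mem_nhds (by simpa using hz))
    have h4 : ∀ᶠ p : ℝ × ℂ in 𝓝 (t, z), |(p.2 + I * (t : ℝ)).im| < r - m :=
      ContinuousAt.eventually_mem (f := fun p : ℝ × ℂ => |(p.2 + I * (t : ℝ)).im|)
        (Continuous.continuousAt (by fun_prop)) (Iio_mem_nhds hzt)
    filter_upwards [h1, h2, h3, h4] with p h1 h2 h3 h4
    have h5 : p.2 + I * (t - p.1) + I * p.1 = p.2 + I * t := by ring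
    exact eq_of_add_eq_of_abs_im_lt ho hc hb hs hKc hK hf hGc hGd' hGf hm hmr h3 h2 h1 ht h5
      (h5 ▸ h4)
  have hval : ∀ z ∈ Ω, G z t = f (z + I * t) := by
    intro z hz
    have him : ∀ σ v : ℝ, (z - I * (σ * v : ℝ)).im = z.im - σ * v := fun σ v => by simp
    have hzm := abs_le.1 (hm z (subset_closure hz))
    have ht1 := ht.1
    have ht2 := ht.2
    rcases le_total 0 (z.im + t) with h | h
    · refine eq_of_eventually_eq_translate ho hGc hGf hloc hz (-1) (fun v hv hcl => ?_)
        ⟨2 * r, by linarith, fun hcl => ?_⟩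
      · have := abs_le.1 (hm _ hcl)
        rw [him] at this
        constructor <;> linarith
      · have := abs_le.1 (hm _ (subset_closure hcl))
        rw [him] at this
        linarith
    · refine eq_of_eventually_eq_translate ho hGc hGf hloc hz 1 (fun v hv hcl => ?_)
        ⟨2 * r, by linarith, fun hcl => ?_⟩
      · have := abs_le.1 (hm _ hcl)
        rw [him] at this
        constructor <;> linarith
      · have := abs_le.1 (hm _ (subset_closure hcl))
        rw [him] at this
        linarith
  have h1 : DifferentiableAt ℂ (fun w => G (w - I * t) t) (z + I * t) :=
    DifferentiableAt.comp (f := fun w => w - I * t) (g := fun z => G z t) (z + I * t)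
      ((hGd' t (Ioo_subset_Icc_self ht)).differentiableAt (ho.mem_nhds (by simpa using hz)))
      (by fun_prop)
  refine h1.congr_of_eventuallyEq ?_
  have h2 : ∀ᶠ w in 𝓝 (z + I * t), w - I * t ∈ Ω :=
    ContinuousAt.eventually_mem (Continuous.continuousAt (by fun_prop))
      (ho.mem_nhds (by simpa using hz))
  filter_upwards [h2] with w hw
  rw [hval _ hw, sub_add_cancel]

/-- An interior point of the union of the translates of the frontier of `Ω` lies on an inner
translate of `Ω`, provided that the frontier is nowhere isolated from `Ω` on the vertical line
through this point. -/
theorem exists_mem_add_eq_of_mem_interior {Ω K : Set ℂ} {r : ℝ}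
    (hK : ∀ p ∈ K, ∃ ζ ∈ frontier Ω, ∃ t ∈ Icc (-r) r, ζ + I * (t : ℝ) = p)
    (hr : ∀ ζ ∈ closure Ω, |ζ.im| < r) {p : ℂ} (hp : p ∈ interior K)
    (hV : ∀ ζ ∈ frontier Ω, ζ.re = p.re → ∀ η > 0, ∃ z ∈ Ω, z.re = ζ.re ∧ ‖z - ζ‖ < η) :
    ∃ z ∈ Ω, ∃ t ∈ Ioo (-r) r, z + I * (t : ℝ) = p := by
  have hev : ∀ σ : ℝ, ∃ η > 0, p + I * (σ * η : ℝ) ∈ K := fun σ => by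
    have h1 : ∀ᶠ η : ℝ in 𝓝[>] 0, p + I * (σ * η : ℝ) ∈ K :=
      (ContinuousAt.eventually_mem (f := fun η : ℝ => p + I * (σ * η : ℝ))
        (Continuous.continuousAt (by fun_prop))
        (by simpa using mem_interior_iff_mem_nhds.1 hp)).filter_mono nhdsWithin_le_nhds
    obtain ⟨η, h, hη⟩ := (h1.and self_mem_nhdsWithin).exists
    exact ⟨η, hη, h⟩
  have hfin : ∀ z ∈ Ω, z.re = p.re → p.im - z.im ∈ Ioo (-r) r →
      ∃ z ∈ Ω, ∃ t ∈ Ioo (-r) r, z + I * (t : ℝ) = p := fun z hz hre him =>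
    ⟨z, hz, _, him, Complex.ext (by simp [hre]) (by simp)⟩
  rcases le_total 0 p.im with h | h
  · obtain ⟨η, hη, hmem⟩ := hev 1
    obtain ⟨ζ, hζ, t, ht, hζp⟩ := hK _ hmem
    have hre : ζ.re = p.re := by simpa using congrArg re hζp
    have him : ζ.im + t = p.im + η := by simpa using congrArg im hζp
    obtain ⟨z, hz, hzre, hzn⟩ := hV ζ hζ hre η hη
    have h1 := abs_lt.1 ((abs_im_le_norm _).trans_lt hzn)
    have h2 := abs_lt.1 (hr z (subset_closure hz))
    rw [sub_im] at h1
    exact hfin z hz (hzre.trans hre) ⟨by linarith, by linarith [ht.2]⟩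
  · obtain ⟨η, hη, hmem⟩ := hev (-1)
    obtain ⟨ζ, hζ, t, ht, hζp⟩ := hK _ hmem
    have hre : ζ.re = p.re := by simpa using congrArg re hζp
    have him : ζ.im + t = p.im - η := by simpa [sub_eq_add_neg] using congrArg im hζp
    obtain ⟨z, hz, hzre, hzn⟩ := hV ζ hζ hre η hη
    have h1 := abs_lt.1 ((abs_im_le_norm _).trans_lt hzn)
    have h2 := abs_lt.1 (hr z (subset_closure hz))
    rw [sub_im] at h1
    exact hfin z hz (hzre.trans hre) ⟨by linarith [ht.1], by linarith⟩

end

/-- Analyticity on vertical translates of a real-analytic Jordan curve symmetric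
with respect to the real axis (Theorem 2.1 of Globevnik,
"Analyticity on translates of a Jordan curve"). -/
theorem analyticity_on_translates_of_symmetric_jordan_curve
    (Ω : Set ℂ) (hΩopen : IsOpen Ω) (hΩconn : IsConnected Ω)
    (hΩbdd : Bornology.IsBounded Ω)
    -- the boundary of Ω is a real-analytic simple closed curve
    (γ : ℝ → ℂ) (hγan : ∀ s : ℝ, AnalyticAt ℝ γ s)
    (hγper : ∀ s : ℝ, γ (s + 2 * Real.pi) = γ s)
    (hγinj : Set.InjOn γ (Set.Ico 0 (2 * Real.pi)))
    (hγ' : ∀ s : ℝ, deriv γ s ≠ 0)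
    (hγrange : Set.range γ = frontier Ω)
    -- Ω is symmetric with respect to the real axis
    (hsym : (fun ζ => (starRingEnd ℂ) ζ) '' Ω = Ω)
    (r : ℝ) (hr : 0 < r)
    -- (Ω̄ - ir) ∩ (Ω̄ + ir) = ∅
    (hdisj : ((fun ζ => ζ - Complex.I * (r : ℂ)) '' closure Ω) ∩
             ((fun ζ => ζ + Complex.I * (r : ℂ)) '' closure Ω) = ∅)
    -- K = ⋃ { bΩ + it : -r ≤ t ≤ r }
    (K : Set ℂ)
    (hK : K = ⋃ t ∈ Set.Icc (-r) r, (fun ζ => ζ + Complex.I * (t : ℂ)) '' frontier Ω)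
    (f : ℂ → ℂ) (hf : ContinuousOn f K)
    -- for each t ∈ [-r, r], f|(bΩ + it) extends continuously to Ω̄ + it,
    -- holomorphically on Ω + it
    (hext : ∀ t ∈ Set.Icc (-r) r, ∃ g : ℂ → ℂ,
      ContinuousOn g ((fun ζ => ζ + Complex.I * (t : ℂ)) '' closure Ω) ∧
      DifferentiableOn ℂ g ((fun ζ => ζ + Complex.I * (t : ℂ)) '' Ω) ∧
      ∀ ζ ∈ (fun ζ => ζ + Complex.I * (t : ℂ)) '' frontier Ω, g ζ = f ζ) :
    DifferentiableOn ℂ f (interior K) := by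
  have hsym' : starRingEnd ℂ ⁻¹' Ω = Ω := by
    rw [← Set.image_eq_preimage_of_inverse (conj_conj (R := ℂ)) (conj_conj (R := ℂ))]
    exact hsym
  have hcl : ∀ ζ ∈ closure Ω, starRingEnd ℂ ζ ∈ closure Ω := fun ζ hζ =>
    map_mem_closure continuous_conj hζ fun w hw => hsym'.symm.subset hw
  obtain ⟨m, hmr, hm, hmt⟩ := exists_abs_im_le_of_disjoint hr hΩconn hΩbdd hcl
    fun ζ hζ ζ' hζ' h => by
      have : ζ - I * r ∈ (∅ : Set ℂ) := hdisj ▸ ⟨⟨ζ, hζ, rfl⟩, ⟨ζ', hζ', h.symm⟩⟩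
      exact this
  have hKmem : ∀ ζ ∈ frontier Ω, ∀ t ∈ Icc (-r) r, ζ + I * (t : ℝ) ∈ K := fun ζ hζ t ht => by
    rw [hK]
    exact mem_biUnion ht ⟨ζ, hζ, rfl⟩
  have hKex : ∀ p ∈ K, ∃ ζ ∈ frontier Ω, ∃ t ∈ Icc (-r) r, ζ + I * (t : ℝ) = p := fun p hp => by
    rw [hK] at hp
    obtain ⟨t, ht, ζ, hζ, h⟩ := mem_iUnion₂.1 hp
    exact ⟨ζ, hζ, t, ht, h⟩
  have hKc : IsCompact K := by
    have h1 : IsCompact (frontier Ω) :=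
      hΩbdd.isCompact_closure.of_isClosed_subset isClosed_frontier frontier_subset_closure
    have h2 : K = (fun p : ℂ × ℝ => p.1 + I * p.2) '' (frontier Ω ×ˢ Icc (-r) r) := by
      ext p
      refine ⟨fun hp => ?_, ?_⟩
      · obtain ⟨ζ, hζ, t, ht, h⟩ := hKex p hp
        exact ⟨(ζ, t), ⟨hζ, ht⟩, h⟩
      · rintro ⟨q, hq, rfl⟩
        exact hKmem _ hq.1 _ hq.2
    rw [h2]
    exact (h1.prod isCompact_Icc).image (by fun_prop)
  choose! g hgc hgd hgf using hext
  have hGd : ∀ t ∈ Icc (-r) r, DiffContOnCl ℂ (fun z => g t (z + I * t)) Ω := fun t ht =>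
    ⟨(hgd t ht).comp (by fun_prop) fun z hz => ⟨z, hz, rfl⟩,
      (hgc t ht).comp (f := fun z => z + I * t) (by fun_prop) fun z hz => ⟨z, hz, rfl⟩⟩
  have hπ : 0 < 2 * Real.pi := by positivity
  have hγc : Continuous γ := continuous_iff_continuousAt.2 fun s => (hγan s).continuousAt
  have hfin := finite_setOf_re_deriv_eq_zero hΩopen hΩconn.nonempty hΩbdd hγan hγrange
    0 (2 * Real.pi)
  refine differentiableOn_of_continuousOn_of_finite_lines isOpen_interior
    (hf.mono interior_subset) (hfin.image fun s => (γ s).re) fun p hp hpX => ?_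
  obtain ⟨z, hz, t, ht, rfl⟩ := exists_mem_add_eq_of_mem_interior hKex
    (fun ζ hζ => (hm ζ hζ).trans_lt hmr) hp fun ζ hζ hre η hη => by
      rw [← hγrange] at hζ
      obtain ⟨s, rfl⟩ := hζ
      have hs : γ (toIcoMod hπ 0 s) = γ s := Function.Periodic.sub_zsmul_eq hγper _
      have hmem := toIcoMod_mem_Ico hπ 0 s
      rw [zero_add] at hmem
      rw [← hs] at hre ⊢
      exact exists_mem_re_eq_of_frontier hΩopen hπ hγc hγper hγinj hγrange
        (hγan _).hasStrictDerivAt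
        (fun h => hpX ⟨_, ⟨Ico_subset_Icc_self hmem, h⟩, hre⟩) hη
  exact differentiableAt_add_of_extends_translates hΩopen hΩconn.isPreconnected hΩbdd hsym' hKc
    hKmem hf hGd (fun ζ hζ t ht => hgf t ht _ ⟨ζ, hζ, rfl⟩) hm hmr hmt hz ht
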